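/- arXiv:2204.01610 — 2 statements merged into one kernel-verified Lean document; each statement's English description precedes it below -/
import Mathlib

section
/- For integers k ≥ 2, n ≥ 1 and 1 ≤ M ≤ kn−1, the probability of selecting an item of highest rank using strategy S(n,k;M) equals Σ_{l=1}^{k−1} [C(M,l)·(k)_l·(k(n−1))_{M−l}] / (kn)_M + k·Σ_{j=1}^{n−1} Σ_{l=1}^{k} [C(M,l)·(k)_l·(k(j−1))_{M−l}] / (kn)_M · 1/(k(n−j+1)−l), where any falling factorial (b)_a with a > b is interpreted as 0. -/
open Finset Filter

open scoped Classical

/-- The sample space `Ω_{n,k}`: sequences of length `k*n` with values in `Fin n`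
(the value `v : Fin n` encodes the rank `v+1`), in which each value appears exactly `k`
times; these are the permutations of the multiset `{1^k, 2^k, …, n^k}`. -/
def multisetPerms (n k : ℕ) : Finset (Fin (k*n) → Fin n) :=
  Finset.univ.filter (fun w => ∀ v : Fin n, (Finset.univ.filter (fun i => w i = v)).card = k)

/-- The maximum (as a `0`-based value) among the first `M` entries of `w`. -/
def firstMax (n k M : ℕ) (w : Fin (k*n) → Fin n) : ℕ :=
  (Finset.univ.filter (fun t : Fin (k*n) => (t : ℕ) < M)).sup (fun t => (w t : ℕ))

/-- The strategy `S(n,k;M)` succeeds on `w`: there is an index `i` beyond the first `M`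
entries whose value is `≥` the maximum of the first `M` entries, and the first such index
carries an item of the highest rank `n`. -/
def succeedsS (n k M : ℕ) (w : Fin (k*n) → Fin n) : Prop :=
  ∃ i : Fin (k*n), M ≤ (i : ℕ) ∧ firstMax n k M w ≤ (w i : ℕ) ∧
    (∀ i' : Fin (k*n), M ≤ (i' : ℕ) → firstMax n k M w ≤ (w i' : ℕ) → i ≤ i') ∧
    (w i : ℕ) + 1 = n

/-- The strategy `S⁺(n,k;M)` succeeds on `w`: there is an index `i` beyond the first `M`
entries whose value is strictly greater than the maximum of the first `M` entries, and the
first such index carries an item of the highest rank `n`. -/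
def succeedsSplus (n k M : ℕ) (w : Fin (k*n) → Fin n) : Prop :=
  ∃ i : Fin (k*n), M ≤ (i : ℕ) ∧ firstMax n k M w < (w i : ℕ) ∧
    (∀ i' : Fin (k*n), M ≤ (i' : ℕ) → firstMax n k M w < (w i' : ℕ) → i ≤ i') ∧
    (w i : ℕ) + 1 = n

/-- `P_{n,k}(S(n,k;M))`: the probability of success of strategy `S(n,k;M)` under the
uniform measure on `Ω_{n,k}`. -/
noncomputable def probS (n k M : ℕ) : ℝ :=
  (((multisetPerms n k).filter (succeedsS n k M)).card : ℝ) / ((multisetPerms n k).card : ℝ)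

/-- `P_{n,k}(S⁺(n,k;M))`: the probability of success of strategy `S⁺(n,k;M)` under the
uniform measure on `Ω_{n,k}`. -/
noncomputable def probSplus (n k M : ℕ) : ℝ :=
  (((multisetPerms n k).filter (succeedsSplus n k M)).card : ℝ) / ((multisetPerms n k).card : ℝ)

/-- The event `A^{(n)}_{M,j,l}`: among the first `M` entries, the rank `j` appears exactly
`l` times and no rank greater than `j` appears. -/
def eventA (n k M j l : ℕ) (w : Fin (k*n) → Fin n) : Prop :=
  ((Finset.univ.filter (fun i : Fin (k*n) => (i : ℕ) < M ∧ (w i : ℕ) + 1 = j)).card = l) ∧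
  ∀ i : Fin (k*n), (i : ℕ) < M → (w i : ℕ) + 1 ≤ j

/-- Double counting by transpositions: if `X` and the position sets `S w` are stable under swapping
the distinguished position `g (S w)` with any position of `S w`, then the value at the
distinguished position is equidistributed over `S w`. -/
lemma card_mul_eq_card_mul_of_swap {N n : ℕ} (X : Finset (Fin N → Fin n))
    (S : (Fin N → Fin n) → Finset (Fin N)) (g : Finset (Fin N) → Fin N) (P : Fin n → Prop)
    [DecidablePred P] (r c : ℕ) (hX : ∀ w ∈ X, ∀ i ∈ S w, w ∘ Equiv.swap (g (S w)) i ∈ X ∧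
      S (w ∘ Equiv.swap (g (S w)) i) = S w)
    (hr : ∀ w ∈ X, #(S w) = r) (hc : ∀ w ∈ X, #{i ∈ S w | P (w i)} = c) :
    #X * c = #{w ∈ X | P (w (g (S w)))} * r := by
  have h1 : #(X.sigma fun w => {i ∈ S w | P (w i)}) = #X * c := by
    rw [card_sigma, sum_congr rfl hc, sum_const, smul_eq_mul]
  have h2 : #({w ∈ X | P (w (g (S w)))}.sigma S) = #{w ∈ X | P (w (g (S w)))} * r := by
    rw [card_sigma, sum_congr rfl fun w hw => hr w (mem_filter.1 hw).1, sum_const, smul_eq_mul]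
  rw [← h1, ← h2]
  have inv : ∀ x : (Σ _ : Fin N → Fin n, Fin N), x.1 ∈ X → x.2 ∈ S x.1 →
      (⟨(x.1 ∘ Equiv.swap (g (S x.1)) x.2) ∘
        Equiv.swap (g (S (x.1 ∘ Equiv.swap (g (S x.1)) x.2))) x.2, x.2⟩ :
        (Σ _ : Fin N → Fin n, Fin N)) = x := by
    rintro ⟨w, i⟩ hw hi
    simp only at hw hi ⊢
    rw [(hX w hw i hi).2]
    congr 1
    funext t
    simp
  refine card_nbij' (fun x => ⟨x.1 ∘ Equiv.swap (g (S x.1)) x.2, x.2⟩)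
    (fun x => ⟨x.1 ∘ Equiv.swap (g (S x.1)) x.2, x.2⟩) ?_ ?_ ?_ ?_
  · rintro ⟨w, i⟩ h
    simp only [coe_sigma, Set.mem_sigma_iff, mem_coe, mem_filter] at h ⊢
    obtain ⟨hw, hi, hp⟩ := h
    rw [(hX w hw i hi).2]
    simpa [(hX w hw i hi).1, hi] using hp
  · rintro ⟨w, i⟩ h
    simp only [coe_sigma, Set.mem_sigma_iff, mem_coe, mem_filter] at h ⊢
    obtain ⟨⟨hw, hp⟩, hi⟩ := h
    rw [(hX w hw i hi).2]
    simpa [(hX w hw i hi).1, hi] using hp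
  · rintro ⟨w, i⟩ h
    simp only [coe_sigma, Set.mem_sigma_iff, mem_coe, mem_filter] at h
    exact inv ⟨w, i⟩ h.1 h.2.1
  · rintro ⟨w, i⟩ h
    simp only [coe_sigma, Set.mem_sigma_iff, mem_coe, mem_filter] at h
    exact inv ⟨w, i⟩ h.1.1 h.2

lemma multisetPerms_nonempty (n k : ℕ) : (multisetPerms n k).Nonempty := by
  refine ⟨fun i => (finProdFinEquiv.symm i).2, ?_⟩
  simp only [multisetPerms, mem_filter, mem_univ, true_and]
  intro v
  refine Eq.trans (Eq.symm ?_) (card_fin k)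
  refine card_bij (fun c _ => finProdFinEquiv (c, v)) ?_ ?_ ?_
  · intro c _
    rw [mem_filter, Equiv.symm_apply_apply]
    exact ⟨mem_univ _, rfl⟩
  · intro a _ b _ h
    simpa using h
  · intro i hi
    refine ⟨(finProdFinEquiv.symm i).1, mem_univ _, ?_⟩
    have : (finProdFinEquiv.symm i).2 = v := (mem_filter.1 hi).2
    rw [← this, Prod.mk.eta, Equiv.apply_symm_apply]

lemma comp_perm_mem_multisetPerms {n k : ℕ} {w : Fin (k*n) → Fin n} (hw : w ∈ multisetPerms n k)
    (σ : Equiv.Perm (Fin (k*n))) : w ∘ σ ∈ multisetPerms n k := by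
  simp only [multisetPerms, mem_filter, mem_univ, true_and] at hw ⊢
  intro v
  exact (card_equiv σ (by simp)).trans (hw v)

lemma card_filter_of_mem_multisetPerms {n k : ℕ} {w : Fin (k*n) → Fin n}
    (hw : w ∈ multisetPerms n k) (P : Fin n → Prop) [DecidablePred P] :
    #{i | P (w i)} = k * #{v | P v} := by
  simp only [multisetPerms, mem_filter, mem_univ, true_and] at hw
  rw [card_eq_sum_card_fiberwise (f := w) (t := ({v | P v} : Finset (Fin n)))
    (fun i hi => by simpa using hi), sum_congr rfl (g := fun _ => k), sum_const, smul_eq_mul,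
    mul_comm]
  intro v hv
  rw [filter_filter]
  refine Eq.trans (congrArg card ?_) (hw v)
  ext i
  simp only [mem_filter, mem_univ, true_and] at hv ⊢
  constructor
  · exact fun h => h.2
  · rintro rfl
    exact ⟨hv, rfl⟩

lemma card_filter_eq_rank {n k : ℕ} {w : Fin (k*n) → Fin n}
    (hw : w ∈ multisetPerms n k) {j : ℕ} (hj : 1 ≤ j) (hjn : j ≤ n) :
    #{i | (w i : ℕ) + 1 = j} = k := by
  rw [card_filter_of_mem_multisetPerms hw fun v => (v : ℕ) + 1 = j]
  have : ({v : Fin n | (v : ℕ) + 1 = j} : Finset (Fin n)) = {⟨j - 1, by omega⟩} := by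
    ext v
    simp only [mem_filter, mem_univ, true_and, mem_singleton, Fin.ext_iff]
    omega
  rw [this, card_singleton, mul_one]

lemma card_filter_rank_lt {n k : ℕ} {w : Fin (k*n) → Fin n}
    (hw : w ∈ multisetPerms n k) {j : ℕ} (hj : 1 ≤ j) (hjn : j ≤ n) :
    #{i | (w i : ℕ) + 1 < j} = k * (j - 1) := by
  rw [card_filter_of_mem_multisetPerms hw fun v => (v : ℕ) + 1 < j]
  have : ({v : Fin n | (v : ℕ) + 1 < j} : Finset (Fin n)) = Iio ⟨j - 1, by omega⟩ := by
    ext v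
    simp only [mem_filter, mem_univ, true_and, mem_Iio, Fin.lt_def]
    omega
  rw [this, Fin.card_Iio]

lemma card_filter_rank_ge {n k : ℕ} {w : Fin (k*n) → Fin n}
    (hw : w ∈ multisetPerms n k) {j : ℕ} (hj : 1 ≤ j) (hjn : j ≤ n) :
    #{i | j ≤ (w i : ℕ) + 1} = k * (n - j + 1) := by
  rw [card_filter_of_mem_multisetPerms hw fun v => j ≤ (v : ℕ) + 1]
  have : ({v : Fin n | j ≤ (v : ℕ) + 1} : Finset (Fin n)) = Ici ⟨j - 1, by omega⟩ := by
    ext v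
    simp only [mem_filter, mem_univ, true_and, mem_Ici, Fin.le_def]
    omega
  rw [this, Fin.card_Ici]
  congr 1
  simp only
  omega

lemma card_filter_split {N : ℕ} (M : ℕ) (P : Fin N → Prop) [DecidablePred P] :
    #{i : Fin N | M ≤ (i : ℕ) ∧ P i} = #{i | P i} - #{i : Fin N | (i : ℕ) < M ∧ P i} := by
  have h := card_filter_add_card_filter_not (s := ({i | P i} : Finset (Fin N)))
    (fun i => (i : ℕ) < M)
  simp only [filter_filter, not_lt] at h
  simp only [and_comm (b := P _)]
  omega

lemma card_fin_val_lt {N M : ℕ} (hM : M ≤ N) : #{i : Fin N | (i : ℕ) < M} = M := by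
  rw [Fin.card_filter_val_lt, min_eq_right hM]

lemma eventA_congr {n k M j l : ℕ} {w w' : Fin (k*n) → Fin n}
    (h : ∀ i : Fin (k*n), (i : ℕ) < M → w' i = w i) :
    eventA n k M j l w' ↔ eventA n k M j l w := by
  have h1 : ({i : Fin (k*n) | (i : ℕ) < M ∧ (w' i : ℕ) + 1 = j} : Finset (Fin (k*n))) =
      ({i : Fin (k*n) | (i : ℕ) < M ∧ (w i : ℕ) + 1 = j} : Finset (Fin (k*n))) := by
    ext i
    simp only [mem_filter, mem_univ, true_and]
    exact and_congr_right fun hi => by rw [h i hi]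
  have h2 : (∀ i : Fin (k*n), (i : ℕ) < M → (w' i : ℕ) + 1 ≤ j) ↔
      ∀ i : Fin (k*n), (i : ℕ) < M → (w i : ℕ) + 1 ≤ j :=
    forall_congr' fun i => forall_congr' fun hi => by rw [h i hi]
  unfold eventA
  rw [h1, h2]

lemma comp_swap_mem_eventA {n k M j l : ℕ} {w : Fin (k*n) → Fin n}
    (hw : w ∈ (multisetPerms n k).filter (eventA n k M j l)) {a b : Fin (k*n)}
    (ha : M ≤ (a : ℕ)) (hb : M ≤ (b : ℕ)) :
    w ∘ Equiv.swap a b ∈ (multisetPerms n k).filter (eventA n k M j l) := by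
  rw [mem_filter] at hw ⊢
  refine ⟨comp_perm_mem_multisetPerms hw.1 _, (eventA_congr fun i hi => ?_).2 hw.2⟩
  rw [Function.comp_apply, Equiv.swap_apply_of_ne_of_ne]
  · rintro rfl
    omega
  · rintro rfl
    omega

/-- In `eventA`, the entries among the first `M` of rank below `j` number `M - l`. -/
lemma card_filter_rank_lt_of_eventA {n k M j l : ℕ} (hM : M ≤ k*n) {w : Fin (k*n) → Fin n}
    (hw : eventA n k M j l w) :
    #{i : Fin (k*n) | (i : ℕ) < M ∧ (w i : ℕ) + 1 < j} = M - l := by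
  have h := card_filter_add_card_filter_not
    (s := ({i : Fin (k*n) | (i : ℕ) < M} : Finset (Fin (k*n)))) (fun i => (w i : ℕ) + 1 = j)
  simp only [filter_filter] at h
  rw [hw.1, card_fin_val_lt hM] at h
  have h' : ({i : Fin (k*n) | (i : ℕ) < M ∧ (w i : ℕ) + 1 < j} : Finset (Fin (k*n))) =
      ({i : Fin (k*n) | (i : ℕ) < M ∧ ¬ (w i : ℕ) + 1 = j} : Finset (Fin (k*n))) := by
    ext i
    simp only [mem_filter, mem_univ, true_and]
    refine and_congr_right fun hi => ?_
    have := hw.2 i hi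
    omega
  rw [h']
  omega

/-- Revealing one more entry after the first `M`. -/
lemma card_eventA_mul_next {n k M j l : ℕ} (hM : M < k*n) (P : Fin n → Prop)
    [DecidablePred P] (c : ℕ)
    (hc : ∀ w ∈ (multisetPerms n k).filter (eventA n k M j l),
      #{i : Fin (k*n) | M ≤ (i : ℕ) ∧ P (w i)} = c) :
    #((multisetPerms n k).filter (eventA n k M j l)) * c =
      #{w ∈ (multisetPerms n k).filter (eventA n k M j l) | P (w ⟨M, hM⟩)} * (k*n - M) := by
  refine card_mul_eq_card_mul_of_swap _ (fun _ => {i : Fin (k*n) | M ≤ (i : ℕ)})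
    (fun _ => ⟨M, hM⟩) P _ _ ?_ ?_ ?_
  · intro w hw i hi
    exact ⟨comp_swap_mem_eventA hw le_rfl (by simpa using hi), rfl⟩
  · intro w _
    have := card_filter_split (N := k*n) M (fun _ => True)
    simpa [card_fin_val_lt hM.le] using this
  · intro w hw
    rw [← hc w hw, filter_filter]

lemma card_filter_lt_succ {N M : ℕ} (hM : M < N) (P : Fin N → Prop) [DecidablePred P] :
    #{i : Fin N | (i : ℕ) < M + 1 ∧ P i} =
      #{i : Fin N | (i : ℕ) < M ∧ P i} + if P ⟨M, hM⟩ then 1 else 0 := by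
  have h : ({i : Fin N | (i : ℕ) < M + 1 ∧ P i} : Finset (Fin N)) =
      ({i : Fin N | (i : ℕ) < M ∧ P i} : Finset (Fin N)) ∪
        if P ⟨M, hM⟩ then {⟨M, hM⟩} else ∅ := by
    ext i
    by_cases hi : i = ⟨M, hM⟩
    · subst hi
      by_cases hp : P ⟨M, hM⟩ <;> simp [hp]
    · have hne : (i : ℕ) ≠ M := fun h => hi (Fin.ext h)
      have : i ∉ (if P ⟨M, hM⟩ then ({⟨M, hM⟩} : Finset (Fin N)) else ∅) := by
        split_ifs <;> simp [hi]
      simp only [mem_filter, mem_univ, true_and, mem_union, this, or_false]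
      exact and_congr_left fun _ => by omega
  rw [h, card_union_of_disjoint]
  · split_ifs <;> simp
  · split_ifs <;> simp

lemma eventA_succ {n k M j l : ℕ} (hM : M < k*n) (w : Fin (k*n) → Fin n) :
    eventA n k (M+1) j l w ↔
      (eventA n k M j l w ∧ (w ⟨M, hM⟩ : ℕ) + 1 < j) ∨
      (1 ≤ l ∧ eventA n k M j (l-1) w ∧ (w ⟨M, hM⟩ : ℕ) + 1 = j) := by
  have hall : (∀ i : Fin (k*n), (i : ℕ) < M + 1 → (w i : ℕ) + 1 ≤ j) ↔
      (∀ i : Fin (k*n), (i : ℕ) < M → (w i : ℕ) + 1 ≤ j) ∧ (w ⟨M, hM⟩ : ℕ) + 1 ≤ j := by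
    refine ⟨fun h => ⟨fun i hi => h i (by omega), h _ (by simp)⟩, fun h i hi => ?_⟩
    rcases Nat.lt_succ_iff_lt_or_eq.1 hi with hi | hi
    · exact h.1 i hi
    · have : i = ⟨M, hM⟩ := Fin.ext hi
      rw [this]
      exact h.2
  unfold eventA
  rw [hall, card_filter_lt_succ hM fun i => (w i : ℕ) + 1 = j]
  by_cases h : (w ⟨M, hM⟩ : ℕ) + 1 = j
  · simp only [h, if_true, lt_irrefl, and_false, false_or, le_refl, and_true]
    constructor
    · rintro ⟨rfl, h2⟩
      exact ⟨by omega, by omega, h2⟩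
    · rintro ⟨h1, h2, h3⟩
      exact ⟨by omega, h3⟩
  · simp only [h, if_false, add_zero, and_false, or_false]
    rw [and_assoc]
    refine and_congr_right fun _ => and_congr_right fun _ => ?_
    omega

lemma card_eventA_mul_lt {n k M j l : ℕ} (hM : M < k*n) (hj : 1 ≤ j) (hjn : j ≤ n) :
    #((multisetPerms n k).filter (eventA n k M j l)) * (k*(j-1) - (M-l)) =
      #{w ∈ (multisetPerms n k).filter (eventA n k M j l) | (w ⟨M, hM⟩ : ℕ) + 1 < j} *
        (k*n - M) := by
  refine card_eventA_mul_next hM (fun v => (v : ℕ) + 1 < j) _ fun w hw => ?_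
  rw [mem_filter] at hw
  rw [card_filter_split, card_filter_rank_lt hw.1 hj hjn,
    card_filter_rank_lt_of_eventA hM.le hw.2]

lemma card_eventA_mul_eq {n k M j l : ℕ} (hM : M < k*n) (hj : 1 ≤ j) (hjn : j ≤ n) :
    #((multisetPerms n k).filter (eventA n k M j l)) * (k - l) =
      #{w ∈ (multisetPerms n k).filter (eventA n k M j l) | (w ⟨M, hM⟩ : ℕ) + 1 = j} *
        (k*n - M) := by
  refine card_eventA_mul_next hM (fun v => (v : ℕ) + 1 = j) _ fun w hw => ?_
  rw [mem_filter] at hw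
  rw [card_filter_split, card_filter_eq_rank hw.1 hj hjn, hw.2.1]

lemma card_eventA_succ_zero {n k M j : ℕ} (hM : M < k*n) (hj : 1 ≤ j) (hjn : j ≤ n) :
    #((multisetPerms n k).filter (eventA n k (M+1) j 0)) * (k*n - M) =
      #((multisetPerms n k).filter (eventA n k M j 0)) * (k*(j-1) - M) := by
  have h := card_eventA_mul_lt (l := 0) hM hj hjn
  rw [Nat.sub_zero] at h
  rw [h, filter_filter]
  congr 3
  funext w
  simp [eventA_succ hM]

lemma card_eventA_succ_succ {n k M j l : ℕ} (hM : M < k*n) (hj : 1 ≤ j) (hjn : j ≤ n) :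
    #((multisetPerms n k).filter (eventA n k (M+1) j (l+1))) * (k*n - M) =
      #((multisetPerms n k).filter (eventA n k M j (l+1))) * (k*(j-1) - (M-(l+1))) +
      #((multisetPerms n k).filter (eventA n k M j l)) * (k - l) := by
  rw [card_eventA_mul_lt hM hj hjn, card_eventA_mul_eq hM hj hjn, ← add_mul, filter_filter,
    filter_filter, ← card_union_of_disjoint, ← filter_or]
  · congr 3
    funext w
    simp [eventA_succ hM]
  · rw [disjoint_filter]
    intro w _ h1 h2
    omega

/-- The probability of `eventA`, with denominators cleared. -/
lemma card_eventA {n k j : ℕ} (hj : 1 ≤ j) (hjn : j ≤ n) (M l : ℕ) (hM : M ≤ k*n) :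
    #((multisetPerms n k).filter (eventA n k M j l)) * (k*n).descFactorial M =
      #(multisetPerms n k) * (M.choose l * k.descFactorial l *
        (k*(j-1)).descFactorial (M-l)) := by
  induction M generalizing l with
  | zero =>
    cases l with
    | zero =>
      have : (multisetPerms n k).filter (eventA n k 0 j 0) = multisetPerms n k :=
        filter_true_of_mem fun w _ => by simp [eventA]
      simp [this]
    | succ l =>
      have : (multisetPerms n k).filter (eventA n k 0 j (l+1)) = ∅ :=
        filter_false_of_mem fun w _ => by simp [eventA]
      simp [this]
  | succ M ih =>
    have hM' : M < k*n := hM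
    rw [Nat.descFactorial_succ, ← mul_assoc]
    cases l with
    | zero =>
      rw [card_eventA_succ_zero hM' hj hjn, mul_right_comm, ih 0 hM'.le]
      simp only [Nat.choose_zero_right, Nat.sub_zero, Nat.descFactorial_succ]
      ring
    | succ l =>
      rw [card_eventA_succ_succ hM' hj hjn,
        show ∀ a x b y d : ℕ, (a*x + b*y)*d = a*d*x + b*d*y from fun _ _ _ _ _ => by ring,
        ih (l+1) hM'.le, ih l hM'.le, Nat.choose_succ_succ, Nat.add_sub_add_right]
      rcases lt_or_ge l M with h | h
      · obtain ⟨d, rfl⟩ : ∃ d, M = l + 1 + d := ⟨M - (l+1), by omega⟩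
        have e1 : l + 1 + d - (l + 1) = d := by omega
        have e2 : l + 1 + d - l = d + 1 := by omega
        rw [e1, e2, Nat.descFactorial_succ, Nat.descFactorial_succ]
        ring
      · rw [Nat.choose_eq_zero_of_lt (show M < l + 1 by omega), Nat.descFactorial_succ]
        ring

lemma firstMax_add_one_of_eventA {n k M j l : ℕ} (hl : 1 ≤ l) {w : Fin (k*n) → Fin n}
    (hw : eventA n k M j l w) : firstMax n k M w + 1 = j := by
  have hpos : 0 < #{i : Fin (k*n) | (i : ℕ) < M ∧ (w i : ℕ) + 1 = j} := by
    rw [hw.1]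
    omega
  obtain ⟨i, hi⟩ := card_pos.1 hpos
  simp only [mem_filter, mem_univ, true_and] at hi
  have h1 : (w i : ℕ) ≤ firstMax n k M w :=
    le_sup (f := fun t => (w t : ℕ)) (by simpa using hi.1)
  have h2 : firstMax n k M w ≤ j - 1 := by
    refine Finset.sup_le fun t ht => ?_
    have := hw.2 t (by simpa using ht)
    omega
  omega

lemma eventA_firstMax {n k M : ℕ} (w : Fin (k*n) → Fin n) :
    eventA n k M (firstMax n k M w + 1)
      #{i : Fin (k*n) | (i : ℕ) < M ∧ (w i : ℕ) + 1 = firstMax n k M w + 1} w := by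
  refine ⟨rfl, fun i hi => ?_⟩
  have : (w i : ℕ) ≤ firstMax n k M w :=
    le_sup (f := fun t => (w t : ℕ)) (by simpa using hi)
  omega

lemma exists_eq_firstMax {n k M : ℕ} (hM1 : 1 ≤ M) (hM : M ≤ k*n) (w : Fin (k*n) → Fin n) :
    ∃ i : Fin (k*n), (i : ℕ) < M ∧ (w i : ℕ) = firstMax n k M w := by
  have hne : ({t : Fin (k*n) | (t : ℕ) < M} : Finset (Fin (k*n))).Nonempty :=
    ⟨⟨0, by omega⟩, by simp; omega⟩
  obtain ⟨i, hi, h⟩ := exists_mem_eq_sup _ hne (fun t => (w t : ℕ))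
  exact ⟨i, by simpa using hi, h.symm⟩

/-- Success counts decompose according to the maximal rank among the first `M` entries and its
multiplicity there. -/
lemma card_succeedsS_eq_sum {n k M : ℕ} (hM1 : 1 ≤ M) (hM : M ≤ k*n) :
    #((multisetPerms n k).filter (succeedsS n k M)) =
      ∑ j ∈ Icc 1 n, ∑ l ∈ Icc 1 k,
        #{w ∈ (multisetPerms n k).filter (eventA n k M j l) | succeedsS n k M w} := by
  rw [← sum_product', card_eq_sum_card_fiberwise (t := Icc 1 n ×ˢ Icc 1 k)
    (f := fun w => (firstMax n k M w + 1,
      #{i : Fin (k*n) | (i : ℕ) < M ∧ (w i : ℕ) + 1 = firstMax n k M w + 1}))]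
  · refine sum_congr rfl fun p hp => ?_
    congr 1
    ext w
    simp only [mem_filter, Prod.ext_iff]
    simp only [mem_product, mem_Icc] at hp
    constructor
    · rintro ⟨⟨h1, h2⟩, h3, h4⟩
      refine ⟨⟨h1, ?_⟩, h2⟩
      rw [← h4, ← h3]
      exact eventA_firstMax w
    · rintro ⟨⟨h1, h2⟩, h3⟩
      have := firstMax_add_one_of_eventA hp.2.1 h2
      exact ⟨⟨h1, h3⟩, this, by rw [this]; exact h2.1⟩
  · intro w hw
    have hw' := (mem_filter.1 (mem_coe.1 hw)).1
    obtain ⟨i, hi, h⟩ := exists_eq_firstMax hM1 hM w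
    have hlt : firstMax n k M w < n := by
      rw [← h]
      exact (w i).2
    simp only [coe_product, coe_Icc, Set.mem_prod, Set.mem_Icc]
    refine ⟨⟨by omega, by omega⟩, card_pos.2 ⟨i, by simp [hi, h]⟩, ?_⟩
    refine le_of_le_of_eq (card_le_card fun t ht => ?_) (card_filter_eq_rank hw'
      (show 1 ≤ firstMax n k M w + 1 by omega) (by omega))
    simp only [mem_filter, mem_univ, true_and] at ht ⊢
    exact ht.2

lemma succeedsS_iff_of_isLeast {n k M : ℕ} {w : Fin (k*n) → Fin n} {a : Fin (k*n)}
    (ha : IsLeast {i : Fin (k*n) | M ≤ (i : ℕ) ∧ firstMax n k M w ≤ (w i : ℕ)} a) :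
    succeedsS n k M w ↔ (w a : ℕ) + 1 = n := by
  constructor
  · rintro ⟨i, h1, h2, h3, h4⟩
    have : i = a := le_antisymm (h3 a ha.1.1 ha.1.2) (ha.2 ⟨h1, h2⟩)
    rwa [← this]
  · intro h
    exact ⟨a, ha.1.1, ha.1.2, fun i h1 h2 => ha.2 ⟨h1, h2⟩, h⟩

/-- Given `eventA` with maximal rank `j`, the first later entry of rank at least `j` is equally
likely to be any of the remaining entries of rank at least `j`. -/
lemma card_eventA_mul_succeedsS {n k M j l : ℕ} (hj : 1 ≤ j) (hjn : j ≤ n)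
    (hl : 1 ≤ l) (hr : l < k*(n-j+1)) (c : ℕ)
    (hc : ∀ w ∈ (multisetPerms n k).filter (eventA n k M j l),
      #{i : Fin (k*n) | M ≤ (i : ℕ) ∧ (w i : ℕ) + 1 = n} = c) :
    #((multisetPerms n k).filter (eventA n k M j l)) * c =
      #{w ∈ (multisetPerms n k).filter (eventA n k M j l) | succeedsS n k M w} *
        (k*(n-j+1) - l) := by
  rcases ((multisetPerms n k).filter (eventA n k M j l)).eq_empty_or_nonempty with h0 | ⟨w₀, hw₀⟩
  · simp [h0]
  set X := (multisetPerms n k).filter (eventA n k M j l) with hX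
  set S : (Fin (k*n) → Fin n) → Finset (Fin (k*n)) :=
    fun w => {i | M ≤ (i : ℕ) ∧ j ≤ (w i : ℕ) + 1} with hS
  have hcard : ∀ w ∈ X, #(S w) = k*(n-j+1) - l := by
    intro w hw
    rw [hX, mem_filter] at hw
    rw [hS, card_filter_split, card_filter_rank_ge hw.1 hj hjn, ← hw.2.1]
    congr 2
    ext i
    simp only [mem_filter, mem_univ, true_and]
    refine and_congr_right fun hi => ?_
    have := hw.2.2 i hi
    omega
  have hne : ∀ w ∈ X, (S w).Nonempty := fun w hw => card_pos.1 (by rw [hcard w hw]; omega)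
  obtain ⟨i₀, -⟩ := hne w₀ hw₀
  set g : Finset (Fin (k*n)) → Fin (k*n) := fun s => if h : s.Nonempty then s.min' h else i₀
    with hg
  have hleast : ∀ w ∈ X, IsLeast (S w : Set (Fin (k*n))) (g (S w)) := by
    intro w hw
    simp only [hg, dif_pos (hne w hw)]
    exact isLeast_min' _ _
  have hsucc : ∀ w ∈ X, (succeedsS n k M w ↔ (w (g (S w)) : ℕ) + 1 = n) := by
    intro w hw
    refine succeedsS_iff_of_isLeast ?_
    convert hleast w hw using 1
    ext i
    have := firstMax_add_one_of_eventA hl (mem_filter.1 hw).2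
    simp only [hS, coe_filter, mem_univ, true_and, Set.mem_ofPred_eq]
    exact and_congr_right fun _ => by omega
  rw [filter_congr hsucc]
  refine card_mul_eq_card_mul_of_swap X S g (fun v => (v : ℕ) + 1 = n) _ _ ?_ hcard ?_
  · intro w hw i hi
    have hgw := (hleast w hw).1
    generalize g (S w) = a at hgw ⊢
    simp only [hS, mem_coe, mem_filter, mem_univ, true_and] at hgw hi
    refine ⟨comp_swap_mem_eventA hw hgw.1 hi.1, ?_⟩
    ext t
    simp only [hS, mem_filter, mem_univ, true_and, Function.comp_apply]
    rcases eq_or_ne t a with rfl | hta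
    · simp [hgw, hi]
    rcases eq_or_ne t i with rfl | hti
    · simp [hgw, hi]
    rw [Equiv.swap_apply_of_ne_of_ne hta hti]
  · intro w hw
    rw [← hc w hw, hS, filter_filter]
    congr 1
    ext i
    simp only [mem_filter, mem_univ, true_and]
    omega

lemma card_succeedsS_of_lt {n k M j l : ℕ} (hk : 1 ≤ k) (hj : 1 ≤ j) (hjn : j < n)
    (hl : 1 ≤ l) (hlk : l ≤ k) :
    #((multisetPerms n k).filter (eventA n k M j l)) * k =
      #{w ∈ (multisetPerms n k).filter (eventA n k M j l) | succeedsS n k M w} *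
        (k*(n-j+1) - l) := by
  have hr : l < k*(n-j+1) := by
    have : 1 ≤ n - j := by omega
    nlinarith
  refine card_eventA_mul_succeedsS hj hjn.le hl hr k fun w hw => ?_
  rw [mem_filter] at hw
  rw [card_filter_split, card_filter_eq_rank hw.1 (by omega) le_rfl]
  have : ({i : Fin (k*n) | (i : ℕ) < M ∧ (w i : ℕ) + 1 = n} : Finset (Fin (k*n))) = ∅ := by
    refine filter_eq_empty_iff.2 fun i _ h => ?_
    have := hw.2.2 i h.1
    omega
  rw [this, card_empty, Nat.sub_zero]

lemma card_succeedsS_top {n k M l : ℕ} (hn : 1 ≤ n) (hl : 1 ≤ l) (hlk : l < k) :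
    #{w ∈ (multisetPerms n k).filter (eventA n k M n l) | succeedsS n k M w} =
      #((multisetPerms n k).filter (eventA n k M n l)) := by
  have h := card_eventA_mul_succeedsS (M := M) hn le_rfl hl (by simpa using hlk) (k - l)
      fun w hw => by
    rw [mem_filter] at hw
    rw [card_filter_split, card_filter_eq_rank hw.1 hn le_rfl, hw.2.1]
  rw [Nat.sub_self, zero_add, mul_one] at h
  exact (Nat.eq_of_mul_eq_mul_right (by omega) h).symm

lemma card_succeedsS_top_full {n k M : ℕ} (hn : 1 ≤ n) :
    #{w ∈ (multisetPerms n k).filter (eventA n k M n k) | succeedsS n k M w} = 0 := by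
  rw [card_eq_zero, filter_eq_empty_iff]
  rintro w hw ⟨i, h1, -, -, h4⟩
  rw [mem_filter] at hw
  have h := card_filter_split M fun i => (w i : ℕ) + 1 = n
  rw [card_filter_eq_rank hw.1 hn le_rfl, hw.2.1, Nat.sub_self, card_eq_zero,
    filter_eq_empty_iff] at h
  exact h (mem_univ i) ⟨h1, h4⟩

lemma card_eventA_div {n k M j l : ℕ} (hM : M ≤ k*n) (hj : 1 ≤ j) (hjn : j ≤ n) :
    (#((multisetPerms n k).filter (eventA n k M j l)) : ℝ) / #(multisetPerms n k) =
      ((M.choose l : ℝ) * (Nat.descFactorial k l : ℝ)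
        * (Nat.descFactorial (k*(j-1)) (M-l) : ℝ)) / (Nat.descFactorial (k*n) M : ℝ) := by
  have h0 : (#(multisetPerms n k) : ℝ) ≠ 0 := by
    exact_mod_cast (card_pos.2 (multisetPerms_nonempty n k)).ne'
  have h1 : (Nat.descFactorial (k*n) M : ℝ) ≠ 0 := by
    exact_mod_cast (Nat.descFactorial_pos.2 hM).ne'
  rw [div_eq_div_iff h0 h1, mul_comm _ (#(multisetPerms n k) : ℝ)]
  exact_mod_cast card_eventA hj hjn M l hM

/-- Proposition 1: exact formula for the success probability of `S(n,k;M)`. -/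
theorem secretary_multirank_formula (n k M : ℕ) (hk : 2 ≤ k) (hn : 1 ≤ n)
    (hM1 : 1 ≤ M) (hM2 : M ≤ k*n - 1) :
    probS n k M =
      (∑ l ∈ Finset.Icc 1 (k-1),
        ((M.choose l : ℝ) * (Nat.descFactorial k l : ℝ)
            * (Nat.descFactorial (k*(n-1)) (M-l) : ℝ))
          / (Nat.descFactorial (k*n) M : ℝ))
      + (k : ℝ) * ∑ j ∈ Finset.Icc 1 (n-1), ∑ l ∈ Finset.Icc 1 k,
          ((M.choose l : ℝ) * (Nat.descFactorial k l : ℝ)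
              * (Nat.descFactorial (k*(j-1)) (M-l) : ℝ))
            / (Nat.descFactorial (k*n) M : ℝ)
          * (1 / (((k*(n-j+1) : ℕ) : ℝ) - (l : ℝ))) := by
  have hM : M ≤ k*n := by omega
  unfold probS
  rw [card_succeedsS_eq_sum hM1 hM]
  obtain ⟨m, rfl⟩ : ∃ m, n = m + 1 := ⟨n - 1, by omega⟩
  obtain ⟨q, rfl⟩ : ∃ q, k = q + 1 := ⟨k - 1, by omega⟩
  rw [sum_Icc_succ_top (by omega : 1 ≤ m + 1), Nat.cast_add, add_div, add_comm]
  congr 1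
  · rw [sum_Icc_succ_top (by omega : 1 ≤ q + 1), card_succeedsS_top_full (by omega),
      add_zero, Nat.cast_sum, sum_div]
    refine sum_congr rfl fun l hl => ?_
    rw [Nat.add_sub_cancel, mem_Icc] at hl
    rw [card_succeedsS_top hn hl.1 (by omega), card_eventA_div hM hn le_rfl]
  · rw [Nat.cast_sum, sum_div, mul_sum]
    refine sum_congr rfl fun j hj => ?_
    rw [mem_Icc] at hj
    rw [Nat.cast_sum, sum_div, mul_sum]
    refine sum_congr rfl fun l hl => ?_
    rw [mem_Icc] at hl
    have hlt : l < (q+1)*(m+1-j+1) := by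
      have : 1 ≤ m + 1 - j := by omega
      nlinarith
    have h := card_succeedsS_of_lt (M := M) (by omega) hj.1 (by omega : j < m + 1) hl.1 hl.2
    rw [← card_eventA_div hM hj.1 (by omega), ← Nat.cast_sub hlt.le]
    have hne : (((q+1)*(m+1-j+1) - l : ℕ) : ℝ) ≠ 0 := by
      exact_mod_cast (Nat.sub_pos_of_lt hlt).ne'
    have h' := congrArg (Nat.cast (R := ℝ)) h
    rw [Nat.cast_mul, Nat.cast_mul, ← div_eq_iff hne] at h'
    rw [← h']
    ring
end

section
/- Let k = 2 and let (M_n) be a sequence of integers with 1 ≤ M_n ≤ 2n−1 and M_n/(2n) → c for some c ∈ (0,1). Then lim_{n→∞} P_{n,2}(S(n,2;M_n)) = −2c(1−c) + (2c−c²)·log(2−c) − (2c+c²)·log c. -/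
open Finset Filter

open scoped Classical

/-- The probability of the event `P` under the uniform measure on the finite type `E`. -/
noncomputable def uniformProb {E : Type*} [Fintype E] (P : E → Prop) : ℝ :=
  ((Finset.univ.filter P).card : ℝ) / (Fintype.card E : ℝ)

section UniformProb

variable {E : Type*} [Fintype E]

lemma uniformProb_congr {P Q : E → Prop} (h : ∀ e, P e ↔ Q e) :
    uniformProb P = uniformProb Q := by
  rw [show P = Q from funext fun e => propext (h e)]

lemma uniformProb_nonneg (P : E → Prop) : 0 ≤ uniformProb P := by
  unfold uniformProb; positivity

lemma uniformProb_mono {P Q : E → Prop} (h : ∀ e, P e → Q e) :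
    uniformProb P ≤ uniformProb Q := by
  unfold uniformProb
  gcongr with e
  exact h e

lemma uniformProb_comp_equiv (σ : E ≃ E) (P : E → Prop) :
    uniformProb (fun e => P (σ e)) = uniformProb P := by
  unfold uniformProb
  congr 2
  refine Finset.card_bij (fun e _ => σ e) (by simp) (fun a _ b _ h => σ.injective h) ?_
  intro b hb
  exact ⟨σ.symm b, by simpa using hb, by simp⟩

lemma uniformProb_eq_sum (P : E → Prop) :
    uniformProb P = (∑ e, if P e then (1 : ℝ) else 0) / (Fintype.card E : ℝ) := by
  simp [uniformProb]

lemma uniformProb_add_not (P Q : E → Prop) :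
    uniformProb (fun e => P e ∧ Q e) + uniformProb (fun e => P e ∧ ¬ Q e) = uniformProb P := by
  simp only [uniformProb_eq_sum, ← add_div, ← Finset.sum_add_distrib]
  congr 1
  refine Finset.sum_congr rfl fun e _ => ?_
  by_cases hP : P e <;> by_cases hQ : Q e <;> simp [hP, hQ]

/-- Double counting: if every outcome of `P` satisfies exactly `m` of the events `R a`, `a ∈ A`,
the joint probabilities sum to `m` times the probability of `P`. -/
lemma sum_uniformProb_and {α : Type*} (A : Finset α) (P : E → Prop) (R : α → E → Prop) (m : ℝ)
    (h : ∀ e, P e → ((A.filter fun a => R a e).card : ℝ) = m) :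
    ∑ a ∈ A, uniformProb (fun e => P e ∧ R a e) = m * uniformProb P := by
  simp only [uniformProb_eq_sum, ← Finset.sum_div, ← mul_div_assoc]
  rw [Finset.sum_comm, Finset.mul_sum]
  congr 1
  refine Finset.sum_congr rfl fun e _ => ?_
  by_cases hP : P e
  · simp [hP, ← h e hP]
  · simp [hP]

lemma uniformProb_exists {α : Type*} (A : Finset α) (R : α → E → Prop)
    (h : ∀ e, ∀ a ∈ A, ∀ b ∈ A, R a e → R b e → a = b) :
    uniformProb (fun e => ∃ a ∈ A, R a e) = ∑ a ∈ A, uniformProb (R a) := by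
  have key := sum_uniformProb_and A (fun e => ∃ a ∈ A, R a e) R 1 fun e ⟨a, ha, hR⟩ => by
    norm_cast
    rw [Finset.card_eq_one]
    refine ⟨a, ?_⟩
    ext b
    simp only [Finset.mem_filter, Finset.mem_singleton]
    exact ⟨fun hb => h e _ hb.1 _ ha hb.2 hR, by rintro rfl; exact ⟨ha, hR⟩⟩
  rw [one_mul] at key
  rw [← key]
  refine Finset.sum_congr rfl fun a ha => uniformProb_congr fun e => ?_
  exact ⟨fun hR => hR.2, fun hR => ⟨⟨a, ha, hR⟩, hR⟩⟩

end UniformProb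

section Arrangements

variable {α : Type*} [Fintype α] [DecidableEq α] {N : ℕ}

/-- In the arrangement `τ`, the items of `S` come after the first `M` positions and the items of
`B` are among them. -/
def splitAt (M : ℕ) (S B : Finset α) (τ : α ≃ Fin N) : Prop :=
  (∀ a ∈ S, M ≤ (τ a : ℕ)) ∧ ∀ a ∈ B, (τ a : ℕ) < M

/-- Among the items of `S`, the item `a` comes first in the arrangement `τ`. -/
def comesFirst (S : Finset α) (a : α) (τ : α ≃ Fin N) : Prop := ∀ b ∈ S, τ a ≤ τ b

/-- The probability that `s` given items all come after the first `M` of `N` positions. -/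
noncomputable def lateProb (N M s : ℕ) : ℝ :=
  ∏ i ∈ Finset.range s, (((N : ℝ) - M - i) / ((N : ℝ) - i))

lemma uniformProb_comp_swap (a b : α) (P : (α ≃ Fin N) → Prop) :
    uniformProb (fun τ => P ((Equiv.swap a b).trans τ)) = uniformProb P :=
  uniformProb_comp_equiv (E := α ≃ Fin N)
    ⟨fun τ => (Equiv.swap a b).trans τ, fun τ => (Equiv.swap a b).trans τ,
      fun τ => by ext; simp, fun τ => by ext; simp⟩ P

lemma uniformProb_splitAt_insert_eq (M : ℕ) (S B : Finset α) {a b : α} (ha : a ∉ S) (hb : b ∉ S)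
    (haB : a ∉ B) (hbB : b ∉ B) :
    uniformProb (splitAt (N := N) M (insert a S) B) =
      uniformProb (splitAt (N := N) M (insert b S) B) := by
  rw [← uniformProb_comp_swap a b (splitAt M (insert b S) B)]
  refine uniformProb_congr fun τ => ?_
  have hne : ∀ T : Finset α, a ∉ T → b ∉ T → ∀ x ∈ T, Equiv.swap a b x = x := fun T h h' x hx =>
    Equiv.swap_apply_of_ne_of_ne (by rintro rfl; exact h hx) (by rintro rfl; exact h' hx)
  simp +contextual [splitAt, hne S ha hb, hne B haB hbB]

lemma uniformProb_splitAt_step {M : ℕ} (hM : M ≤ N) (hα : Fintype.card α = N) (S : Finset α)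
    {a : α} (ha : a ∉ S) :
    ((N : ℝ) - S.card) * uniformProb (splitAt (N := N) M (insert a S) ∅) =
      ((N : ℝ) - M - S.card) * uniformProb (splitAt (N := N) M S ∅) := by
  have key := sum_uniformProb_and Sᶜ (splitAt (N := N) M S ∅) (fun b τ => M ≤ (τ b : ℕ))
    ((N : ℝ) - M - S.card) fun τ hτ => by
      have h1 : Sᶜ.filter (fun b => M ≤ (τ b : ℕ)) =
          (univ.filter fun b => M ≤ (τ b : ℕ)) \ S := by
        ext b; simp [and_comm]
      have h2 : (univ.filter fun b => M ≤ (τ b : ℕ)).card = N - M := by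
        rw [← Finset.card_map τ.toEmbedding]
        have : (univ.filter fun b => M ≤ (τ b : ℕ)).map τ.toEmbedding =
            univ.filter fun i : Fin N => ¬ (i : ℕ) < M := by
          ext i
          simp only [Finset.mem_map_equiv, Finset.mem_filter, Finset.mem_univ, true_and,
            Equiv.apply_symm_apply, not_lt]
        rw [this, Finset.filter_not, Finset.card_sdiff_of_subset (by simp), Fin.card_filter_val_lt]
        simp [hM]
      have h3 : S ⊆ univ.filter fun b => M ≤ (τ b : ℕ) := fun b hb => by simpa using hτ.1 b hb
      have h4 := Finset.card_le_card h3
      trans ((Sᶜ.filter fun b => M ≤ (τ b : ℕ)).card : ℝ)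
      · congr
      rw [h1, Finset.card_sdiff_of_subset h3, Nat.cast_sub h4, h2, Nat.cast_sub hM]
  rw [← key, Finset.sum_congr rfl (g := fun _ => uniformProb (splitAt (N := N) M (insert a S) ∅)),
    Finset.sum_const, nsmul_eq_mul, Finset.card_compl, Nat.cast_sub (Finset.card_le_univ _), hα]
  intro b hb
  rw [uniformProb_splitAt_insert_eq M S ∅ ha (by simpa using hb) (by simp) (by simp)]
  refine uniformProb_congr fun τ => ?_
  simp [splitAt, and_comm]

lemma uniformProb_splitAt_empty {M : ℕ} (hM : M ≤ N) (hα : Fintype.card α = N) (S : Finset α) :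
    uniformProb (splitAt (N := N) M S ∅) = lateProb N M S.card := by
  induction S using Finset.induction_on with
  | empty =>
    have : Nonempty (α ≃ Fin N) := ⟨Fintype.equivFinOfCardEq hα⟩
    simp [lateProb, uniformProb_eq_sum, splitAt]
  | insert a S ha ih =>
    have h := uniformProb_splitAt_step hM hα S ha
    have hlt : (S.card : ℝ) < N := by
      rw [← hα]
      exact_mod_cast Finset.card_lt_univ_of_notMem ha
    rw [Finset.card_insert_of_notMem ha, lateProb, Finset.prod_range_succ, ← lateProb, ← ih]
    have : (N : ℝ) - S.card ≠ 0 := by linarith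
    field_simp
    linarith

lemma uniformProb_splitAt_insert (M : ℕ) (S B : Finset α) (b : α) :
    uniformProb (splitAt (N := N) M S (insert b B)) =
      uniformProb (splitAt (N := N) M S B) - uniformProb (splitAt (N := N) M (insert b S) B) := by
  rw [eq_sub_iff_add_eq', ← uniformProb_add_not (splitAt M S B) (fun τ => M ≤ (τ b : ℕ))]
  congr 1 <;>
  · refine uniformProb_congr fun τ => ?_
    simp only [splitAt, Finset.forall_mem_insert]
    grind

lemma uniformProb_splitAt_comesFirst_eq (M : ℕ) {S B : Finset α} (hSB : Disjoint S B) {a b : α}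
    (ha : a ∈ S) (hb : b ∈ S) :
    uniformProb (fun τ : α ≃ Fin N => splitAt M S B τ ∧ comesFirst S a τ) =
      uniformProb (fun τ : α ≃ Fin N => splitAt M S B τ ∧ comesFirst S b τ) := by
  rw [← uniformProb_comp_swap a b (fun τ => splitAt M S B τ ∧ comesFirst S b τ)]
  refine uniformProb_congr fun τ => ?_
  have hS : ∀ p : α → Prop, (∀ x ∈ S, p (Equiv.swap a b x)) ↔ ∀ x ∈ S, p x := by
    have hmem : ∀ x ∈ S, Equiv.swap a b x ∈ S := fun x hx => by
      rw [Equiv.swap_apply_def]; split_ifs <;> assumption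
    exact fun p => ⟨fun h x hx => by simpa using h _ (hmem x hx), fun h x hx => h _ (hmem x hx)⟩
  have hB : ∀ x ∈ B, Equiv.swap a b x = x := fun x hx =>
    Equiv.swap_apply_of_ne_of_ne
      (by rintro rfl; exact Finset.disjoint_left.1 hSB ha hx)
      (by rintro rfl; exact Finset.disjoint_left.1 hSB hb hx)
  simp +contextual only [splitAt, comesFirst, Equiv.trans_apply, Equiv.swap_apply_right, hB,
    hS (fun x => M ≤ (τ x : ℕ)), hS (fun x => τ a ≤ τ x)]

/-- By symmetry, the first item of `S` lies in `T ⊆ S` with probability `#T / #S`. -/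
lemma uniformProb_splitAt_comesFirst (M : ℕ) {S B T : Finset α} (hSB : Disjoint S B)
    (hT : T ⊆ S) :
    uniformProb (fun τ : α ≃ Fin N => ∃ a ∈ T, splitAt M S B τ ∧ comesFirst S a τ) =
      (T.card : ℝ) / S.card * uniformProb (splitAt (N := N) M S B) := by
  rcases S.eq_empty_or_nonempty with rfl | ⟨s, hs⟩
  · obtain rfl : T = ∅ := by simpa using hT
    simp [uniformProb]
  have hsum : ∀ U ⊆ S,
      uniformProb (fun τ : α ≃ Fin N => ∃ a ∈ U, splitAt M S B τ ∧ comesFirst S a τ) =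
      U.card * uniformProb (fun τ : α ≃ Fin N => splitAt M S B τ ∧ comesFirst S s τ) := by
    intro U hU
    rw [uniformProb_exists U _ fun τ a ha b hb h h' =>
      τ.injective (le_antisymm (h.2 b (hU hb)) (h'.2 a (hU ha))), ← nsmul_eq_mul, ← Finset.sum_const]
    exact Finset.sum_congr rfl fun a ha => uniformProb_splitAt_comesFirst_eq M hSB (hU ha) hs
  have hall : uniformProb (splitAt (N := N) M S B) =
      uniformProb (fun τ : α ≃ Fin N => ∃ a ∈ S, splitAt M S B τ ∧ comesFirst S a τ) := by
    refine uniformProb_congr fun τ => ⟨fun h => ?_, fun ⟨_, _, h, _⟩ => h⟩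
    obtain ⟨a, ha, hmin⟩ := S.exists_min_image τ ⟨s, hs⟩
    exact ⟨a, ha, h, hmin⟩
  have : (S.card : ℝ) ≠ 0 := by exact_mod_cast (Finset.card_pos.2 ⟨s, hs⟩).ne'
  rw [hall, hsum T hT, hsum S subset_rfl]
  field_simp

end Arrangements

section Words

variable {n : ℕ}

/-- The sequence of ranks induced by an arrangement of the labelled items `Fin n × Fin 2`. -/
def rankWord (τ : Fin n × Fin 2 ≃ Fin (2 * n)) : Fin (2 * n) → Fin n := fun i => (τ.symm i).1

lemma rankWord_mem_multisetPerms (τ : Fin n × Fin 2 ≃ Fin (2 * n)) :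
    rankWord τ ∈ multisetPerms n 2 := by
  simp only [multisetPerms, Finset.mem_filter, Finset.mem_univ, true_and]
  intro v
  rw [← Finset.card_map τ.symm.toEmbedding]
  have : (univ.filter fun i => rankWord τ i = v).map τ.symm.toEmbedding =
      ({v} : Finset (Fin n)) ×ˢ (univ : Finset (Fin 2)) := by
    ext a
    rw [Finset.mem_map_equiv, Finset.mem_filter, Finset.mem_product, Finset.mem_singleton]
    simp [rankWord]
  rw [this]
  simp

lemma exists_rankWord_eq {w : Fin (2 * n) → Fin n} (hw : w ∈ multisetPerms n 2) :
    ∃ τ, rankWord τ = w := by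
  simp only [multisetPerms, Finset.mem_filter, Finset.mem_univ, true_and] at hw
  have hcard : ∀ v, Fintype.card {i // w i = v} = 2 := fun v => by
    rw [Fintype.card_subtype]
    convert hw v
  let σ : Fin (2 * n) ≃ Fin n × Fin 2 := (Equiv.sigmaFiberEquiv w).symm.trans
    ((Equiv.sigmaCongrRight fun v => Fintype.equivFinOfCardEq (hcard v)).trans
      (Equiv.sigmaEquivProd (Fin n) (Fin 2)))
  exact ⟨σ.symm, rfl⟩

/-- Each word arises from the same number of arrangements of labelled items. -/
lemma card_rankWord_fiber {w : Fin (2 * n) → Fin n} (hw : w ∈ multisetPerms n 2) :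
    (univ.filter fun τ => rankWord τ = w).card =
      (univ.filter fun π : Equiv.Perm (Fin n × Fin 2) => ∀ a, (π.symm a).1 = a.1).card := by
  obtain ⟨ρ, rfl⟩ := exists_rankWord_eq hw
  symm
  refine Finset.card_bij (fun π _ => π.trans ρ) ?_ ?_ ?_
  · intro π hπ
    simp only [Finset.mem_filter, Finset.mem_univ, true_and] at hπ ⊢
    funext i
    simp [rankWord, hπ]
  · intro π _ π' _ h
    ext1 a
    simpa using DFunLike.congr_fun h a
  · intro τ hτ
    simp only [Finset.mem_filter, Finset.mem_univ, true_and] at hτ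
    refine ⟨τ.trans ρ.symm, ?_, by ext; simp⟩
    simp only [Finset.mem_filter, Finset.mem_univ, true_and]
    intro a
    simpa [rankWord] using congr_fun hτ (ρ a)

lemma probS_eq_uniformProb (n M : ℕ) :
    probS n 2 M = uniformProb fun τ => succeedsS n 2 M (rankWord τ) := by
  set K := (univ.filter fun π : Equiv.Perm (Fin n × Fin 2) => ∀ a, (π.symm a).1 = a.1).card
    with hK
  have hcount : ∀ Q : (Fin (2 * n) → Fin n) → Prop,
      (univ.filter fun τ => Q (rankWord τ)).card = ((multisetPerms n 2).filter Q).card * K := by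
    intro Q
    rw [Finset.card_eq_sum_card_fiberwise (f := rankWord) (t := (multisetPerms n 2).filter Q),
      Finset.sum_const_nat]
    · intro w hw
      rw [Finset.mem_filter] at hw
      rw [hK, ← card_rankWord_fiber hw.1, Finset.filter_filter]
      congr 1
      ext τ
      simp only [Finset.mem_filter, Finset.mem_univ, true_and, and_iff_right_iff_imp]
      rintro rfl
      exact hw.2
    · intro τ hτ
      simpa [rankWord_mem_multisetPerms] using hτ
  have hK0 : (K : ℝ) ≠ 0 := by
    have : 0 < K := Finset.card_pos.2 ⟨Equiv.refl _, by simp⟩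
    exact_mod_cast this.ne'
  have htot := hcount fun _ => True
  rw [Finset.filter_true, Finset.filter_true, Finset.card_univ] at htot
  rw [probS, uniformProb, hcount, htot]
  push_cast
  rw [mul_div_mul_right _ _ hK0]

lemma firstMax_eq_iff {k M : ℕ} (hM : 0 < M) (hn : 0 < k * n) (w : Fin (k * n) → Fin n)
    (v : Fin n) : firstMax n k M w = v ↔
      (∀ i : Fin (k * n), (i : ℕ) < M → w i ≤ v) ∧ ∃ i : Fin (k * n), (i : ℕ) < M ∧ w i = v := by
  unfold firstMax
  have hle : ∀ i : Fin (k * n), (i : ℕ) < M → (w i : ℕ) ≤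
      (univ.filter fun t : Fin (k * n) => (t : ℕ) < M).sup fun t => (w t : ℕ) := fun i hi =>
    Finset.le_sup (f := fun t => (w t : ℕ)) (by simpa using hi)
  constructor
  · intro h
    refine ⟨fun i hi => Fin.le_def.2 (h ▸ hle i hi), ?_⟩
    obtain ⟨i, hi, hi'⟩ := Finset.exists_mem_eq_sup
      (univ.filter fun t : Fin (k * n) => (t : ℕ) < M) ⟨⟨0, hn⟩, by simpa using hM⟩
      (fun t => (w t : ℕ))
    exact ⟨i, by simpa using hi, Fin.ext (hi'.symm.trans h)⟩
  · rintro ⟨h, i, hi, rfl⟩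
    refine le_antisymm (Finset.sup_le fun t ht => h t (by simpa using ht)) (hle i hi)

/-- The items that come late when `v` is the highest rank among the early items and `L` is the set
of labels of the early items of rank `v`. -/
def lateItems (v : Fin n) (L : Finset (Fin 2)) : Finset (Fin n × Fin 2) :=
  univ.filter fun a => v < a.1 ∨ a.1 = v ∧ a.2 ∉ L

/-- The items of rank `v` with label in `L`. -/
def itemsOfRank (v : Fin n) (L : Finset (Fin 2)) : Finset (Fin n × Fin 2) :=
  univ.filter fun a => a.1 = v ∧ a.2 ∈ L

/-- The late items of the highest rank. -/
def lateTopItems (v : Fin n) (L : Finset (Fin 2)) : Finset (Fin n × Fin 2) :=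
  (lateItems v L).filter fun a => (a.1 : ℕ) + 1 = n

lemma disjoint_lateItems_itemsOfRank (v : Fin n) (L : Finset (Fin 2)) :
    Disjoint (lateItems v L) (itemsOfRank v L) := by
  rw [Finset.disjoint_left]
  simp only [lateItems, itemsOfRank, Finset.mem_filter, Finset.mem_univ, true_and]
  rintro a (h | h) h'
  · exact h.ne' h'.1
  · exact h.2 h'.2

lemma mem_lateItems_iff {M : ℕ} {v : Fin n} {L : Finset (Fin 2)}
    {τ : Fin n × Fin 2 ≃ Fin (2 * n)} (h : splitAt M (lateItems v L) (itemsOfRank v L) τ)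
    (a : Fin n × Fin 2) : a ∈ lateItems v L ↔ M ≤ (τ a : ℕ) ∧ v ≤ a.1 := by
  refine ⟨fun ha => ⟨h.1 a ha, ?_⟩, fun ⟨ha, hv⟩ => ?_⟩
  · simp only [lateItems, Finset.mem_filter, Finset.mem_univ, true_and] at ha
    exact ha.elim le_of_lt fun h => h.1.ge
  · simp only [lateItems, Finset.mem_filter, Finset.mem_univ, true_and]
    rcases hv.lt_or_eq with hv | hv
    · exact Or.inl hv
    · exact Or.inr ⟨hv.symm, fun hL => ha.not_gt (h.2 a (by simp [itemsOfRank, hv, hL]))⟩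

lemma firstMax_rankWord_of_splitAt {M : ℕ} (hM : 0 < M) {v : Fin n} {L : Finset (Fin 2)}
    (hL : L.Nonempty) {τ : Fin n × Fin 2 ≃ Fin (2 * n)}
    (h : splitAt M (lateItems v L) (itemsOfRank v L) τ) : firstMax n 2 M (rankWord τ) = v := by
  rw [firstMax_eq_iff hM (by have := v.pos; omega)]
  refine ⟨fun i hi => ?_, ?_⟩
  · by_contra! hv
    have := h.1 (τ.symm i) (by simp [lateItems]; exact Or.inl hv)
    rw [Equiv.apply_symm_apply] at this
    omega
  · obtain ⟨x, hx⟩ := hL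
    exact ⟨τ (v, x), h.2 _ (by simp [itemsOfRank, hx]), by simp [rankWord]⟩

lemma splitAt_of_firstMax_rankWord {M : ℕ} (hM : 0 < M) {v : Fin n}
    {τ : Fin n × Fin 2 ≃ Fin (2 * n)} (h : firstMax n 2 M (rankWord τ) = v) :
    ∃ L : Finset (Fin 2), L.Nonempty ∧ splitAt M (lateItems v L) (itemsOfRank v L) τ := by
  rw [firstMax_eq_iff hM (by have := v.pos; omega)] at h
  obtain ⟨hle, i, hi, hv⟩ := h
  refine ⟨univ.filter fun x => (τ (v, x) : ℕ) < M, ⟨(τ.symm i).2, ?_⟩, ?_, ?_⟩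
  · rw [rankWord] at hv
    simp [← hv, hi]
  · intro a ha
    by_contra! hlt
    have hva := hle (τ a) hlt
    simp only [lateItems, Finset.mem_filter, Finset.mem_univ, true_and] at ha
    simp only [rankWord, Equiv.symm_apply_apply] at hva
    rcases ha with ha | ⟨rfl, ha⟩
    · exact ha.not_ge hva
    · exact ha hlt
  · rintro ⟨b, x⟩ hb
    simp only [itemsOfRank, Finset.mem_filter, Finset.mem_univ, true_and] at hb
    obtain ⟨rfl, hb⟩ := hb
    exact hb

lemma succeedsS_rankWord_iff {M : ℕ} {v : Fin n} {L : Finset (Fin 2)}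
    {τ : Fin n × Fin 2 ≃ Fin (2 * n)} (h : splitAt M (lateItems v L) (itemsOfRank v L) τ)
    (hmax : firstMax n 2 M (rankWord τ) = v) :
    succeedsS n 2 M (rankWord τ) ↔ ∃ a ∈ lateTopItems v L, comesFirst (lateItems v L) a τ := by
  simp only [succeedsS, hmax, lateTopItems, Finset.mem_filter, mem_lateItems_iff h, comesFirst]
  rw [← τ.exists_congr_right]
  refine exists_congr fun a => ?_
  rw [← τ.forall_congr_right]
  simp only [rankWord, Equiv.symm_apply_apply, Fin.val_fin_le]
  grind

lemma succeedsS_and_firstMax_iff {M : ℕ} (hM : 0 < M) (v : Fin n)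
    (τ : Fin n × Fin 2 ≃ Fin (2 * n)) :
    succeedsS n 2 M (rankWord τ) ∧ firstMax n 2 M (rankWord τ) = v ↔
      ∃ L ∈ ({{0}, {1}, {0, 1}} : Finset (Finset (Fin 2))), ∃ a ∈ lateTopItems v L,
        splitAt M (lateItems v L) (itemsOfRank v L) τ ∧ comesFirst (lateItems v L) a τ := by
  have hne : ∀ L : Finset (Fin 2), L ∈ ({{0}, {1}, {0, 1}} : Finset (Finset (Fin 2))) ↔
      L.Nonempty := by decide
  simp only [hne]
  constructor
  · rintro ⟨hs, hmax⟩
    obtain ⟨L, hL, h⟩ := splitAt_of_firstMax_rankWord hM hmax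
    obtain ⟨a, ha, ha'⟩ := (succeedsS_rankWord_iff h hmax).1 hs
    exact ⟨L, hL, a, ha, h, ha'⟩
  · rintro ⟨L, hL, a, ha, h, ha'⟩
    have hmax := firstMax_rankWord_of_splitAt hM hL h
    exact ⟨(succeedsS_rankWord_iff h hmax).2 ⟨a, ha, ha'⟩, hmax⟩

lemma eq_of_splitAt {M : ℕ} {v : Fin n} {L L' : Finset (Fin 2)}
    {τ : Fin n × Fin 2 ≃ Fin (2 * n)} (h : splitAt M (lateItems v L) (itemsOfRank v L) τ)
    (h' : splitAt M (lateItems v L') (itemsOfRank v L') τ) : L = L' := by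
  ext x
  have := mem_lateItems_iff h (v, x)
  have := mem_lateItems_iff h' (v, x)
  simp only [lateItems, Finset.mem_filter, Finset.mem_univ, true_and, lt_irrefl, false_or] at *
  tauto

lemma card_lateItems (v : Fin n) (L : Finset (Fin 2)) :
    (lateItems v L).card = 2 * (n - 1 - v) + (2 - L.card) := by
  have : lateItems v L = Finset.Ioi v ×ˢ univ ∪ {v} ×ˢ Lᶜ := by
    ext a
    simp only [lateItems, Finset.mem_filter, Finset.mem_univ, true_and, Finset.mem_union,
      Finset.mem_product, Finset.mem_Ioi, Finset.mem_singleton, Finset.mem_compl, and_true]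
  rw [this, Finset.card_union_of_disjoint, Finset.card_product, Finset.card_product,
    Finset.card_compl]
  · simp [mul_comm]
  · simp only [Finset.disjoint_left, Finset.mem_product, Finset.mem_Ioi, Finset.mem_singleton]
    rintro a ⟨h, -⟩ ⟨h', -⟩
    exact h.ne' h'

lemma card_lateTopItems (v : Fin n) (L : Finset (Fin 2)) :
    (lateTopItems v L).card = min 2 (lateItems v L).card := by
  rcases eq_or_ne ((v : ℕ) + 1) n with hv | hv
  · have : lateTopItems v L = lateItems v L := by
      refine Finset.filter_true_of_mem fun a ha => ?_
      simp only [lateItems, Finset.mem_filter, Finset.mem_univ, true_and] at ha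
      rcases ha with ha | ha
      · rw [Fin.lt_def] at ha; omega
      · rw [ha.1, hv]
    rw [this, card_lateItems, min_eq_right]
    omega
  · have hlt : (v : ℕ) + 1 < n := by omega
    have : lateTopItems v L = {⟨n - 1, by omega⟩} ×ˢ univ := by
      ext a
      simp only [lateTopItems, lateItems, Finset.mem_filter, Finset.mem_univ, true_and,
        Finset.mem_product, Finset.mem_singleton, and_true, Fin.lt_def, Fin.ext_iff]
      omega
    rw [this, card_lateItems, min_eq_left (by omega)]
    simp

lemma uniformProb_splitAt_single {M : ℕ} (hM : M ≤ 2 * n) (v : Fin n) (x : Fin 2) :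
    uniformProb (splitAt (N := 2 * n) M (lateItems v {x}) (itemsOfRank v {x})) =
      lateProb (2 * n) M (2 * (n - 1 - v) + 1) - lateProb (2 * n) M (2 * (n - 1 - v) + 2) := by
  have hB : itemsOfRank v {x} = insert (v, x) ∅ := by
    ext a; simp [itemsOfRank, Prod.ext_iff]
  have hS : insert (v, x) (lateItems v {x}) = lateItems v ∅ := by
    ext ⟨a, z⟩
    simp [lateItems, Prod.ext_iff]
    tauto
  have hcard : Fintype.card (Fin n × Fin 2) = 2 * n := by simp [mul_comm]
  rw [hB, uniformProb_splitAt_insert, hS, uniformProb_splitAt_empty hM hcard,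
    uniformProb_splitAt_empty hM hcard, card_lateItems, card_lateItems]
  simp

lemma uniformProb_splitAt_pair {M : ℕ} (hM : M ≤ 2 * n) (v : Fin n) :
    uniformProb (splitAt (N := 2 * n) M (lateItems v {0, 1}) (itemsOfRank v {0, 1})) =
      lateProb (2 * n) M (2 * (n - 1 - v)) - 2 * lateProb (2 * n) M (2 * (n - 1 - v) + 1) +
        lateProb (2 * n) M (2 * (n - 1 - v) + 2) := by
  have hB : itemsOfRank v {0, 1} = insert (v, 1) (insert (v, 0) ∅) := by
    ext ⟨a, z⟩; simp [itemsOfRank, Prod.ext_iff]; tauto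
  have hS : ∀ L : Finset (Fin 2), ∀ x, insert (v, x) (lateItems v L) = lateItems v (L.erase x) := by
    intro L x
    ext ⟨a, z⟩
    simp [lateItems, Prod.ext_iff]
    tauto
  have hcard : Fintype.card (Fin n × Fin 2) = 2 * n := by simp [mul_comm]
  rw [hB]
  simp only [uniformProb_splitAt_insert, hS, uniformProb_splitAt_empty hM hcard, card_lateItems,
    show (({0, 1} : Finset (Fin 2)).erase 0).card = 1 by decide,
    show (({0, 1} : Finset (Fin 2)).erase 1).card = 1 by decide,
    show ((({0, 1} : Finset (Fin 2)).erase 1).erase 0).card = 0 by decide,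
    show ({0, 1} : Finset (Fin 2)).card = 2 by decide]
  norm_num
  ring

/-- The probability of success when `r` ranks exceed the highest rank of the first `M` of `N`
items. -/
noncomputable def successTerm (N M r : ℕ) : ℝ :=
  2 * ((min 2 (2 * r + 1) : ℕ) / (2 * r + 1 : ℕ) *
    (lateProb N M (2 * r + 1) - lateProb N M (2 * r + 2))) +
  (min 2 (2 * r) : ℕ) / (2 * r : ℕ) *
    (lateProb N M (2 * r) - 2 * lateProb N M (2 * r + 1) + lateProb N M (2 * r + 2))

lemma uniformProb_succeedsS_and_firstMax {M : ℕ} (hM : 0 < M) (hM' : M ≤ 2 * n) {r : ℕ}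
    (hr : r < n) :
    uniformProb (fun τ => succeedsS n 2 M (rankWord τ) ∧ firstMax n 2 M (rankWord τ) + r + 1 = n) =
      successTerm (2 * n) M r := by
  set v : Fin n := ⟨n - 1 - r, by omega⟩ with hv
  have hvr : n - 1 - (v : ℕ) = r := by simp [hv]; omega
  have hiff : ∀ m, m + r + 1 = n ↔ m = (v : ℕ) := fun m => by simp [hv]; omega
  simp only [hiff]
  rw [uniformProb_congr (succeedsS_and_firstMax_iff hM v), uniformProb_exists]
  · rw [Finset.sum_congr rfl fun L _ => uniformProb_splitAt_comesFirst M
        (disjoint_lateItems_itemsOfRank v L)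
        (show lateTopItems v L ⊆ _ from Finset.filter_subset _ _),
      Finset.sum_insert (by decide), Finset.sum_insert (by decide), Finset.sum_singleton,
      uniformProb_splitAt_single hM', uniformProb_splitAt_single hM',
      uniformProb_splitAt_pair hM']
    simp only [card_lateTopItems, card_lateItems, hvr, Finset.card_singleton,
      show ({0, 1} : Finset (Fin 2)).card = 2 by decide, successTerm]
    norm_num
    ring
  · rintro τ L - L' - ⟨_, _, h, _⟩ ⟨_, _, h', _⟩
    exact eq_of_splitAt h h'

lemma firstMax_lt {k M : ℕ} (hn : 0 < n) (w : Fin (k * n) → Fin n) : firstMax n k M w < n := by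
  rw [firstMax, Finset.sup_lt_iff (by simpa using hn)]
  exact fun i _ => (w i).2

lemma probS_eq_tsum {M : ℕ} (hn : 0 < n) (hM : 0 < M) (hM' : M ≤ 2 * n) :
    probS n 2 M = ∑' r, if r < n then successTerm (2 * n) M r else 0 := by
  rw [tsum_eq_sum (s := Finset.range n) fun r hr => if_neg (by simpa using hr), probS_eq_uniformProb,
    Finset.sum_congr rfl fun r hr => by
      rw [if_pos (Finset.mem_range.1 hr),
        ← uniformProb_succeedsS_and_firstMax hM hM' (Finset.mem_range.1 hr)],
    ← uniformProb_exists]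
  · refine uniformProb_congr fun τ => ⟨fun h => ?_, fun ⟨_, _, h, _⟩ => h⟩
    have := firstMax_lt (M := M) hn (rankWord τ)
    exact ⟨n - 1 - firstMax n 2 M (rankWord τ), Finset.mem_range.2 (by omega), h, by omega⟩
  · rintro τ r - r' - ⟨-, h⟩ ⟨-, h'⟩
    omega

lemma successTerm_nonneg_and_le {M : ℕ} (hM : 0 < M) (hM' : M ≤ 2 * n) {r : ℕ} (hr : r < n) :
    0 ≤ successTerm (2 * n) M r ∧ successTerm (2 * n) M r ≤ lateProb (2 * n) M (2 * r) := by
  rw [← uniformProb_succeedsS_and_firstMax hM hM' hr]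
  refine ⟨uniformProb_nonneg _, ?_⟩
  set v : Fin n := ⟨n - 1 - r, by omega⟩ with hv
  have hcard : (lateItems v univ).card = 2 * r := by
    rw [card_lateItems]
    simp [hv]
    omega
  rw [← hcard, ← uniformProb_splitAt_empty hM' (by simp [mul_comm])]
  refine uniformProb_mono fun τ hτ => ?_
  obtain ⟨L, -, h, -⟩ := splitAt_of_firstMax_rankWord (v := v) hM (τ := τ) (by simp [hv]; omega)
  refine ⟨fun a ha => h a ?_, by simp⟩
  simp only [lateItems, Finset.mem_filter, Finset.mem_univ, true_and, not_true, and_false,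
    or_false] at ha ⊢
  exact Or.inl ha

end Words

section Limits

lemma lateProb_succ (N M s : ℕ) :
    lateProb N M (s + 1) = lateProb N M s * (((N : ℝ) - M - s) / ((N : ℝ) - s)) :=
  Finset.prod_range_succ _ _

lemma lateProb_le_pow {N M : ℕ} (hM : M ≤ N) {s : ℕ} (hs : s ≤ N) :
    0 ≤ lateProb N M s ∧ lateProb N M s ≤ (1 - (M : ℝ) / N) ^ s := by
  have hnonneg : ∀ s ≤ N, 0 ≤ lateProb N M s := fun s hs => by
    obtain ⟨S, -, rfl⟩ := Finset.exists_subset_card_eq (s := (univ : Finset (Fin N))) (by simpa)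
    rw [← uniformProb_splitAt_empty hM (Fintype.card_fin N)]
    exact uniformProb_nonneg _
  refine ⟨hnonneg s hs, ?_⟩
  induction s with
  | zero => simp [lateProb]
  | succ s ih =>
    rw [lateProb_succ, pow_succ]
    have hsN : (s : ℝ) < N := by exact_mod_cast hs
    have hMN : (M : ℝ) ≤ N := by exact_mod_cast hM
    have hN : (0 : ℝ) < N := (Nat.cast_nonneg s).trans_lt hsN
    have hle : ((N : ℝ) - M - s) / ((N : ℝ) - s) ≤ 1 - (M : ℝ) / N := by
      rw [one_sub_div hN.ne', div_le_div_iff₀ (by linarith) hN]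
      nlinarith [mul_nonneg (Nat.cast_nonneg (α := ℝ) M) (Nat.cast_nonneg (α := ℝ) s)]
    calc _ ≤ lateProb N M s * (1 - (M : ℝ) / N) :=
          mul_le_mul_of_nonneg_left hle (hnonneg s (by omega))
      _ ≤ _ := by
          refine mul_le_mul_of_nonneg_right (ih (by omega)) ?_
          rw [sub_nonneg, div_le_one hN]
          exact hMN

variable {M : ℕ → ℕ} {c : ℝ}

lemma tendsto_lateProb (hlim : Tendsto (fun n : ℕ => (M n : ℝ) / (2 * n)) atTop (nhds c)) (s : ℕ) :
    Tendsto (fun n : ℕ => lateProb (2 * n) (M n) s) atTop (nhds ((1 - c) ^ s)) := by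
  have hterm : ∀ i : ℕ, Tendsto (fun n : ℕ => (((2 * n : ℕ) : ℝ) - M n - i) / (((2 * n : ℕ) : ℝ) - i))
      atTop (nhds (1 - c)) := fun i => by
    have hi : Tendsto (fun n : ℕ => (i : ℝ) / (2 * n)) atTop (nhds 0) :=
      tendsto_const_nhds.div_atTop
        (tendsto_natCast_atTop_atTop.const_mul_atTop (by norm_num : (0 : ℝ) < 2))
    have := ((hlim.const_sub 1).sub hi).div (hi.const_sub 1) (by norm_num)
    rw [sub_zero, sub_zero, div_one] at this
    refine this.congr' ?_
    filter_upwards [eventually_gt_atTop 0] with n hn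
    have : (n : ℝ) ≠ 0 := by positivity
    have h2 : (2 * n : ℝ) ≠ 0 := by positivity
    rw [Pi.div_apply, one_sub_div h2, ← sub_div, one_sub_div h2, div_div_div_cancel_right₀ h2]
    push_cast
    rfl
  simpa [lateProb] using tendsto_finsetProd (Finset.range s) fun i _ => hterm i

/-- The limit of `successTerm`, where `x` is the limiting proportion of late positions. -/
noncomputable def limitTerm (x : ℝ) (r : ℕ) : ℝ :=
  2 * ((min 2 (2 * r + 1) : ℕ) / (2 * r + 1 : ℕ) * (x ^ (2 * r + 1) - x ^ (2 * r + 2))) +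
  (min 2 (2 * r) : ℕ) / (2 * r : ℕ) * (x ^ (2 * r) - 2 * x ^ (2 * r + 1) + x ^ (2 * r + 2))

lemma tendsto_successTerm (hlim : Tendsto (fun n : ℕ => (M n : ℝ) / (2 * n)) atTop (nhds c))
    (r : ℕ) :
    Tendsto (fun n : ℕ => if r < n then successTerm (2 * n) (M n) r else 0) atTop
      (nhds (limitTerm (1 - c) r)) := by
  have h := tendsto_lateProb hlim
  refine Tendsto.congr' ?_ (((((h (2 * r + 1)).sub (h (2 * r + 2))).const_mul
    (((min 2 (2 * r + 1) : ℕ) : ℝ) / (2 * r + 1 : ℕ))).const_mul 2).add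
    ((((h (2 * r)).sub ((h (2 * r + 1)).const_mul 2)).add (h (2 * r + 2))).const_mul
      (((min 2 (2 * r) : ℕ) : ℝ) / (2 * r : ℕ))))
  filter_upwards [eventually_gt_atTop r] with n hn
  rw [if_pos hn, successTerm]

lemma hasSum_limitTerm (hc : c ∈ Set.Ioo (0 : ℝ) 1) :
    HasSum (limitTerm (1 - c))
      (-2*c*(1-c) + (2*c - c^2) * Real.log (2-c) - (2*c + c^2) * Real.log c) := by
  obtain ⟨h0, h1⟩ := hc
  obtain ⟨x, hx⟩ : ∃ x, x = 1 - c := ⟨_, rfl⟩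
  rw [← hx]
  have hx0 : 0 < x := by linarith
  have hx1 : |x| < 1 := by rw [abs_of_pos hx0]; linarith
  have hodd := (Real.hasSum_log_sub_log_of_abs_lt_one hx1).mul_left (2 * c)
  have hcorr := (hasSum_ite_eq (0 : ℕ) (2 * c * x))
  have heven : HasSum (fun r : ℕ => (x ^ 2) ^ r / (r : ℝ)) (-Real.log (1 - x ^ 2)) := by
    have := Real.hasSum_pow_div_log_of_abs_lt_one (x := x ^ 2)
      (by rw [abs_of_pos (by positivity)]; nlinarith)
    rw [← hasSum_nat_add_iff' 1]
    simpa using this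
  have hsum := (hodd.sub hcorr).add (heven.mul_left (c ^ 2))
  have hlog : Real.log (1 - x ^ 2) = Real.log c + Real.log (2 - c) := by
    rw [← Real.log_mul h0.ne' (by linarith)]
    congr 1
    rw [hx]
    ring
  have hfun : limitTerm x = fun r : ℕ =>
      (2 * c * (2 * (1 / (2 * (r : ℝ) + 1)) * x ^ (2 * r + 1)) - if r = 0 then 2 * c * x else 0) +
        c ^ 2 * ((x ^ 2) ^ r / r) := by
    funext r
    rcases r with _ | r
    · simp [limitTerm]
      rw [hx]
      ring
    · rw [limitTerm, min_eq_left (by omega), min_eq_left (by omega), if_neg (by omega)]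
      push_cast
      rw [show c = 1 - x by rw [hx]; ring]
      field_simp
      ring
  rw [hlog, show 1 + x = 2 - c by rw [hx]; ring, show 1 - x = c by rw [hx]; ring] at hsum
  rw [hfun]
  refine Eq.subst (motive := HasSum _) ?_ hsum
  ring

end Limits

/-- The case `k = 2` of Theorem 1. -/
theorem secretary_multirank_limit_two (M : ℕ → ℕ) (c : ℝ) (hc : c ∈ Set.Ioo (0:ℝ) 1)
    (hM : ∀ n, 1 ≤ n → 1 ≤ M n ∧ M n ≤ 2*n - 1)
    (hlim : Tendsto (fun n : ℕ => (M n : ℝ) / ((2 : ℝ) * n)) atTop (nhds c)) :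
    Tendsto (fun n : ℕ => probS n 2 (M n)) atTop
      (nhds (-2*c*(1-c) + (2*c - c^2) * Real.log (2-c) - (2*c + c^2) * Real.log c)) := by
  have ⟨hc0, hc1⟩ := hc
  rw [← (hasSum_limitTerm hc).tsum_eq]
  have hlim' : ∀ᶠ n : ℕ in atTop, 1 - (M n : ℝ) / (2 * n) < 1 - c / 2 := by
    filter_upwards [hlim.eventually (lt_mem_nhds (half_lt_self hc0))] with n hn
    linarith
  have hbound : Summable fun r : ℕ => (1 - c / 2) ^ (2 * r) := by
    simp only [pow_mul]
    exact summable_geometric_of_lt_one (by positivity) (by nlinarith)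
  refine (tendsto_tsum_of_dominated_convergence hbound (tendsto_successTerm hlim) ?_).congr' ?_
  · filter_upwards [hlim', eventually_ge_atTop 1] with n hn hn1 r
    obtain ⟨hM1, hM2⟩ := hM n hn1
    have hM3 : M n ≤ 2 * n := by omega
    split_ifs with hr
    · obtain ⟨hnonneg, hle⟩ := successTerm_nonneg_and_le hM1 hM3 hr
      rw [Real.norm_of_nonneg hnonneg]
      refine hle.trans ((lateProb_le_pow hM3 (by omega)).2.trans ?_)
      push_cast
      refine pow_le_pow_left₀ ?_ hn.le _
      rw [sub_nonneg, div_le_one (by positivity)]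
      exact_mod_cast hM3
    · rw [norm_zero, pow_mul]
      positivity
  · filter_upwards [eventually_ge_atTop 1] with n hn
    obtain ⟨hM1, hM2⟩ := hM n hn
    exact (probS_eq_tsum hn hM1 (by omega)).symm
end
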